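/- arXiv:1612.07589 — 2 statements merged into one kernel-verified Lean document; each statement's English description precedes it below -/
import Mathlib

section
/- Soundness of Algorithm 1 (maximization): for any family F of finsets of α, any R : Finset α, and every n ∈ ℕ, Cardmax R F_n ⊆ Setmax R F, where (F_n) is the maximization iteration of Algorithm 1 starting from F; that is, every solution output at any iteration of Algorithm 1 is a subset-maximal solution of the original family F. -/
/-- Subset-maximal solutions of a family `F` of finsets, relative to `R`. -/
def Setmax {α : Type*} [DecidableEq α] (R : Finset α) (F : Set (Finset α)) :
    Set (Finset α) :=
  {s ∈ F | ¬ ∃ s' ∈ F, s ∩ R ⊂ s' ∩ R}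

/-- Cardinality-maximal solutions of a family `F` of finsets, relative to `R`. -/
def Cardmax {α : Type*} [DecidableEq α] (R : Finset α) (F : Set (Finset α)) :
    Set (Finset α) :=
  {s ∈ F | ∀ s' ∈ F, (s' ∩ R).card ≤ (s ∩ R).card}

/-- The maximization iteration of Algorithm 1 starting from `F`:
`F_0 = F` and `F_{n+1}` consists of those members of `F_n` whose restriction to
`R` is not contained in the restriction of any cardinality-maximal member of `F_n`. -/
def iterMax {α : Type*} [DecidableEq α] (R : Finset α) (F : Set (Finset α)) :
    ℕ → Set (Finset α)
  | 0 => F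
  | n + 1 =>
      {s' ∈ iterMax R F n | ¬ ∃ s ∈ Cardmax R (iterMax R F n), s' ∩ R ⊆ s ∩ R}

theorem iterMax_subset_aux {α : Type*} [DecidableEq α]
    (R : Finset α) (F : Set (Finset α)) (n : ℕ) : iterMax R F n ⊆ F := by
  induction n with
  | zero => exact fun s hs => hs
  | succ n ih => exact fun s hs => ih hs.1

theorem iterMax_upward_aux {α : Type*} [DecidableEq α]
    (R : Finset α) (F : Set (Finset α)) (n : ℕ) :
    ∀ s ∈ iterMax R F n, ∀ t ∈ F, s ∩ R ⊆ t ∩ R → t ∈ iterMax R F n := by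
  induction n with
  | zero => exact fun s _ t ht _ => ht
  | succ n ih =>
    intro s hs t ht hst
    refine ⟨ih s hs.1 t ht hst, ?_⟩
    rintro ⟨u, hu, htu⟩
    exact hs.2 ⟨u, hu, hst.trans htu⟩

/-- Soundness of Algorithm 1 (maximization): every solution output at any
iteration is a subset-maximal solution of the original family `F`. -/
theorem cardmax_iterMax_subset_setmax {α : Type*} [DecidableEq α]
    (R : Finset α) (F : Set (Finset α)) (n : ℕ) :
    Cardmax R (iterMax R F n) ⊆ Setmax R F := by
  intro s hs
  refine ⟨iterMax_subset_aux R F n hs.1, ?_⟩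
  rintro ⟨t, ht, hst⟩
  have h := hs.2 t (iterMax_upward_aux R F n s hs.1 t ht hst.subset)
  exact absurd (Finset.card_lt_card hst) (not_lt.mpr h)
end

section
/- Soundness of the minimization variant of Algorithm 1: for any family F of finsets of α, any R : Finset α, and every n ∈ ℕ, Cardmin R G_n ⊆ Setmin R F, where (G_n) is the minimization iteration starting from F; that is, every solution output at any iteration is a subset-minimal solution of the original family F. -/
/-- Subset-minimal solutions of a family `F` of finsets, relative to `R`. -/
def Setmin {α : Type*} [DecidableEq α] (R : Finset α) (F : Set (Finset α)) :
    Set (Finset α) :=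
  {s ∈ F | ¬ ∃ s' ∈ F, s' ∩ R ⊂ s ∩ R}

/-- Cardinality-minimal solutions of a family `F` of finsets, relative to `R`. -/
def Cardmin {α : Type*} [DecidableEq α] (R : Finset α) (F : Set (Finset α)) :
    Set (Finset α) :=
  {s ∈ F | ∀ s' ∈ F, (s ∩ R).card ≤ (s' ∩ R).card}

/-- The minimization iteration of Algorithm 1 starting from `F`:
`G_0 = F` and `G_{n+1}` consists of those members of `G_n` whose restriction to
`R` does not contain the restriction of any cardinality-minimal member of `G_n`. -/
def iterMin {α : Type*} [DecidableEq α] (R : Finset α) (F : Set (Finset α)) :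
    ℕ → Set (Finset α)
  | 0 => F
  | n + 1 =>
      {s' ∈ iterMin R F n | ¬ ∃ s ∈ Cardmin R (iterMin R F n), s ∩ R ⊆ s' ∩ R}

theorem iterMin_subset_aux {α : Type*} [DecidableEq α] (R : Finset α) (F : Set (Finset α))
    (n : ℕ) : iterMin R F n ⊆ F := by
  induction n with
  | zero => exact fun s hs => hs
  | succ n ih => exact fun s hs => ih hs.1

theorem iterMin_down_aux {α : Type*} [DecidableEq α] (R : Finset α) (F : Set (Finset α))
    (n : ℕ) : ∀ s ∈ iterMin R F n, ∀ t ∈ F, t ∩ R ⊆ s ∩ R → t ∈ iterMin R F n := by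
  induction n with
  | zero => exact fun _ _ t ht _ => ht
  | succ n ih =>
    intro s hs t ht hts
    refine ⟨ih s hs.1 t ht hts, ?_⟩
    rintro ⟨u, hu, hut⟩
    exact hs.2 ⟨u, hu, hut.trans hts⟩

/-- Soundness of the minimization variant of Algorithm 1: every solution output
at any iteration is a subset-minimal solution of the original family `F`. -/
theorem cardmin_iterMin_subset_setmin {α : Type*} [DecidableEq α]
    (R : Finset α) (F : Set (Finset α)) (n : ℕ) :
    Cardmin R (iterMin R F n) ⊆ Setmin R F := by
  intro s hs
  refine ⟨iterMin_subset_aux R F n hs.1, ?_⟩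
  rintro ⟨t, ht, hts⟩
  have h1 := hs.2 t (iterMin_down_aux R F n s hs.1 t ht hts.1)
  have h2 := Finset.card_lt_card hts
  omega
end
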